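/- Let q be a prime power, n ≥ 2, and α, β ∈ F_{q^n}^* with Tr_{F_{q^n}/F_q}(β) ≠ 0. Let A denote the number of pairs (x, y) ∈ F_{q^n} × F_{q^n} with y^q − y = α·x^{q−1} − β, and set d := gcd(q − 1, n). Then |A − q^n| ≤ q^{n/2}(d − 1) + q^{(n+1)/2}(q − 1 − d), the inequality being between real numbers. (Equivalently, the number #X(F_{q^n}) = A + 1 of rational points of the nonsingular projective Artin–Schreier curve X : y^q − y = α x^{q−1} − β satisfies |#X(F_{q^n}) − (q^n + 1)| ≤ q^{n/2}(d − 1) + q^{(n+1)/2}(q − 1 − d).) -/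

import Mathlib

@[to_additive]
theorem MonoidHom.natCard_fiber_eq_of_card_ker_le {G H : Type*} [Group G] [Group H] [Finite G]
    (f : G →* G) (g : G →* H) (hgf : ∀ x, g (f x) = 1) (hg : Function.Surjective g)
    (hker : Nat.card f.ker ≤ Nat.card H) [DecidableEq H] (w : G) :
    Nat.card {x // f x = w} = if g w = 1 then Nat.card H else 0 := by
  have hle : f.range ≤ g.ker := by
    rintro _ ⟨x, rfl⟩
    exact hgf x
  have h1 : Nat.card f.ker * Nat.card f.range = Nat.card G := by
    rw [← Subgroup.index_ker, Subgroup.card_mul_index]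
  have h2 : Nat.card g.ker * Nat.card H = Nat.card G := by
    rw [← Subgroup.card_mul_index g.ker, Subgroup.index_ker, MonoidHom.range_eq_top.2 hg,
      Subgroup.card_top]
  have h3 : Nat.card f.range ≤ Nat.card g.ker :=
    Nat.card_le_card_of_injective _ (Subgroup.inclusion_injective hle)
  have hkerpos : 0 < Nat.card g.ker := Nat.card_pos
  have hcard : Nat.card f.ker = Nat.card H := by
    refine le_antisymm hker ?_
    by_contra! hlt
    have : Nat.card f.ker * Nat.card f.range < Nat.card g.ker * Nat.card H := by
      calc _ ≤ Nat.card f.ker * Nat.card g.ker := Nat.mul_le_mul_left _ h3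
        _ < _ := by rw [mul_comm]; exact Nat.mul_lt_mul_of_pos_left hlt hkerpos
    omega
  have hHpos : 0 < Nat.card H := by
    rw [← hcard]; exact Nat.card_pos
  have hrange : f.range = g.ker := by
    refine Subgroup.eq_of_le_of_card_ge hle ?_
    rw [← h2, hcard, mul_comm] at h1
    exact (Nat.eq_of_mul_eq_mul_right hHpos h1).ge
  split_ifs with hw
  · obtain ⟨x, rfl⟩ : w ∈ f.range := hrange ▸ hw
    rw [← hcard]
    refine Nat.card_congr ((Equiv.mulLeft x⁻¹).subtypeEquiv fun y => ?_)
    rw [Equiv.coe_mulLeft, MonoidHom.mem_ker, map_mul, map_inv, inv_mul_eq_one, eq_comm]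
  · rw [Nat.card_eq_zero]
    refine Or.inl ⟨fun ⟨x, hx⟩ => hw (hx ▸ hgf x)⟩

section FiniteFields

variable {F K : Type*} [Field F] [Field K] [Fintype F] [Fintype K] [Algebra F K]

theorem FiniteField.natCard_pow_card_sub_self_eq [DecidableEq F] (u : K) :
    Nat.card {y : K // y ^ Fintype.card F - y = u} =
      if Algebra.trace F K u = 0 then Fintype.card F else 0 := by
  let f : K →+ K := (FiniteField.frobeniusAlgHom F K : K →+ K) - AddMonoidHom.id K
  have hf (y : K) : f y = y ^ Fintype.card F - y := rfl
  have := AddMonoidHom.natCard_fiber_eq_of_card_ker_le f (Algebra.trace F K : K →+ F)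
    (fun y => ?_) (Algebra.trace_surjective F K) ?_ u
  · simpa [hf, Nat.card_eq_fintype_card] using this
  · have h := Algebra.trace_eq_of_algEquiv (FiniteField.frobeniusAlgEquivOfAlgebraic F K) y
    simpa [hf, sub_eq_zero] using h
  · classical
    have h1 := Fintype.one_lt_card (α := F)
    have hne := FiniteField.X_pow_card_sub_X_ne_zero K h1
    calc Nat.card f.ker
        ≤ Nat.card ((Polynomial.X ^ Fintype.card F - Polynomial.X :
            Polynomial K).roots.toFinset) := by
          refine Nat.card_le_card_of_injective (fun y => ⟨y, ?_⟩) fun y z h => Subtype.ext ?_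
          · have := y.2
            rw [AddMonoidHom.mem_ker, hf] at this
            rw [Multiset.mem_toFinset, Polynomial.mem_roots hne]
            simpa only [Polynomial.IsRoot.def, Polynomial.eval_sub, Polynomial.eval_pow,
              Polynomial.eval_X] using this
          · exact congrArg (fun a : (Polynomial.X ^ Fintype.card F - Polynomial.X :
              Polynomial K).roots.toFinset => (a : K)) h
      _ ≤ Nat.card F := by
          rw [Nat.card_eq_fintype_card, Fintype.card_coe, Nat.card_eq_fintype_card]
          refine (Multiset.toFinset_card_le _).trans ((Polynomial.card_roots' _).trans ?_)
          rw [FiniteField.X_pow_card_sub_X_natDegree_eq K h1]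

theorem FiniteField.natCard_units_pow_card_sub_one_eq [DecidableEq F] (w : Kˣ) :
    Nat.card {x : Kˣ // x ^ (Fintype.card F - 1) = w} =
      if Algebra.norm F (w : K) = 1 then Fintype.card F - 1 else 0 := by
  have := MonoidHom.natCard_fiber_eq_of_card_ker_le (powMonoidHom (Fintype.card F - 1) : Kˣ →* Kˣ)
    (Units.map (Algebra.norm F (S := K))) (fun y => ?_)
    (FiniteField.unitsMap_norm_surjective F K) ?_ w
  · simpa [Units.ext_iff, Nat.card_units, Fintype.card_units] using this
  · rw [powMonoidHom_apply, map_pow, ← Fintype.card_units, pow_card_eq_one]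
  · rw [IsCyclic.card_powMonoidHom_ker, Nat.card_units F, Nat.card_eq_fintype_card (α := F)]
    exact Nat.gcd_le_right _ (Nat.sub_pos_of_lt Fintype.one_lt_card)

/-- The pullback of a multiplicative character along the norm. -/
noncomputable def MulChar.compNorm (K : Type*) [Field K] [Algebra F K]
    (χ : MulChar F ℂ) : MulChar K ℂ :=
  MulChar.ofUnitHom (χ.toUnitHom.comp (Units.map (Algebra.norm F (S := K))))

omit [Fintype F] in
theorem MulChar.compNorm_apply (χ : MulChar F ℂ) (x : K) :
    χ.compNorm K x = χ (Algebra.norm F x) := by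
  by_cases hx : x = 0
  · rw [hx, MulChar.map_zero, Algebra.norm_zero, MulChar.map_zero]
  · lift x to Kˣ using IsUnit.mk0 x hx
    simp [MulChar.compNorm]

omit [Fintype F] in
theorem MulChar.compNorm_one :
    (1 : MulChar F ℂ).compNorm K = 1 := by
  ext x
  rw [compNorm_apply, MulChar.one_apply_coe, MulChar.one_apply (x.isUnit.map _)]

omit [Fintype F] in
theorem MulChar.compNorm_ne_one {χ : MulChar F ℂ}
    (hχ : χ ≠ 1) : χ.compNorm K ≠ 1 := by
  contrapose! hχ
  ext u
  obtain ⟨x, hx⟩ := FiniteField.unitsMap_norm_surjective F K u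
  have := congrArg (fun φ : MulChar K ℂ => φ x) hχ
  rw [MulChar.one_apply_coe] at this ⊢
  rw [← this, compNorm_apply, ← hx]
  rfl

theorem MulChar.sum_apply_eq_ite [DecidableEq F] [Fintype (MulChar F ℂ)] (a : F) :
    ∑ χ : MulChar F ℂ, χ a = if a = 1 then (Fintype.card F - 1 : ℂ) else 0 := by
  split_ifs with ha
  · have h := MulChar.card_eq_card_units_of_hasEnoughRootsOfUnity F ℂ
    rw [Nat.card_eq_fintype_card, Nat.card_units, Nat.card_eq_fintype_card] at h
    simp [ha, h, Nat.cast_sub Fintype.card_pos]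
  · obtain ⟨χ, hχ⟩ := MulChar.exists_apply_ne_one_of_hasEnoughRootsOfUnity F ℂ ha
    refine eq_zero_of_mul_eq_self_left hχ ?_
    simp only [Finset.mul_sum, ← MulChar.mul_apply]
    exact Fintype.sum_bijective _ (Group.mulLeft_bijective χ) _ _ fun χ' ↦ rfl

theorem MulChar.card_pow_eq_one [Fintype (MulChar F ℂ)] [DecidableEq (MulChar F ℂ)] (n : ℕ) :
    Finset.card {χ : MulChar F ℂ | χ ^ n = 1} = Nat.gcd (Fintype.card F - 1) n := by
  obtain ⟨e⟩ := MulChar.mulEquiv_units F ℂ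
  have : IsCyclic (MulChar F ℂ) := isCyclic_of_surjective e.symm e.symm.surjective
  have h := IsCyclic.card_powMonoidHom_ker (G := MulChar F ℂ) n
  rw [MulChar.card_eq_card_units_of_hasEnoughRootsOfUnity F ℂ, Nat.card_units,
    Nat.card_eq_fintype_card (α := F)] at h
  rw [← h, ← Fintype.card_subtype, ← Nat.card_eq_fintype_card]
  rfl

theorem norm_gaussSum_eq_sqrt_card {χ : MulChar F ℂ} (hχ : χ ≠ 1) {ψ : AddChar F ℂ}
    (hψ : ψ.IsPrimitive) : ‖gaussSum χ ψ‖ = √(Fintype.card F) := by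
  have h := gaussSum_mul_gaussSum_eq_card hχ hψ
  rw [← star_gaussSum_eq, Complex.star_def, Complex.mul_conj, Complex.normSq_eq_norm_sq] at h
  rw [eq_comm, Real.sqrt_eq_iff_mul_self_eq (by positivity) (norm_nonneg _), ← sq]
  exact_mod_cast h.symm

/-- The pullback of an additive character along the trace. -/
noncomputable def AddChar.compTrace (K : Type*) [Field K] [Algebra F K] (ψ : AddChar F ℂ) :
    AddChar K ℂ :=
  ψ.compAddMonoidHom (Algebra.trace F K : K →+ F)

omit [Fintype F] [Fintype K] in
theorem AddChar.compTrace_apply (ψ : AddChar F ℂ) (x : K) :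
    ψ.compTrace K x = ψ (Algebra.trace F K x) := rfl

theorem AddChar.compTrace_ne_one {ψ : AddChar F ℂ} (hψ : ψ ≠ 1) : ψ.compTrace K ≠ 1 := by
  contrapose! hψ
  ext a
  obtain ⟨x, rfl⟩ := Algebra.trace_surjective F K a
  rw [← compTrace_apply, hψ]
  simp

theorem sum_units_eq_sum {K M : Type*} [DivisionRing K] [Fintype K] [Fintype Kˣ] [AddCommMonoid M]
    (f : K → M) (hf : f 0 = 0) : ∑ x : Kˣ, f x = ∑ x : K, f x := by
  rw [← Finset.sum_subset (Finset.subset_univ ((Finset.univ : Finset Kˣ).map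
    ⟨Units.val, Units.val_injective⟩)), Finset.sum_map]
  · rfl
  · intro x _ hx
    by_cases h : x = 0
    · rw [h, hf]
    · exact absurd (Finset.mem_map.2 ⟨Units.mk0 x h, Finset.mem_univ _, rfl⟩) hx

theorem MulChar.norm_apply_eq_one (χ : MulChar K ℂ) {a : K} (ha : a ≠ 0) : ‖χ a‖ = 1 := by
  refine Complex.norm_eq_one_of_pow_eq_one (n := Fintype.card K - 1) ?_
    (Nat.sub_ne_zero_of_lt Fintype.one_lt_card)
  rw [← map_pow, FiniteField.pow_card_sub_one_eq_one a ha, map_one]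

open Classical in
theorem natCard_artinSchreier_eq_sum (α β : K) (htr : Algebra.trace F K β ≠ 0) :
    Nat.card {p : K × K //
        p.2 ^ Fintype.card F - p.2 = α * p.1 ^ (Fintype.card F - 1) - β} =
      ∑ w : Kˣ, (if Algebra.norm F (w : K) = 1 then Fintype.card F - 1 else 0) *
        (if Algebra.trace F K (α * w - β) = 0 then Fintype.card F else 0) := by
  set q := Fintype.card F with hq
  have hq1 : 1 < q := Fintype.one_lt_card
  calc _ = Nat.card (Σ x : K, {y : K // y ^ q - y = α * x ^ (q - 1) - β}) :=
        Nat.card_congr (Equiv.subtypeProdEquivSigmaSubtype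
          fun x y : K => y ^ q - y = α * x ^ (q - 1) - β)
    _ = ∑ x : K, if Algebra.trace F K (α * x ^ (q - 1) - β) = 0 then q else 0 := by
        rw [Nat.card_sigma]
        exact Finset.sum_congr rfl fun x _ => FiniteField.natCard_pow_card_sub_self_eq _
    _ = ∑ x : Kˣ, if Algebra.trace F K (α * ((x ^ (q - 1) : Kˣ) : K) - β) = 0 then q else 0 := by
        rw [← sum_units_eq_sum]
        · simp
        · rw [zero_pow (Nat.sub_ne_zero_of_lt hq1), mul_zero, zero_sub, map_neg,
            if_neg (neg_ne_zero.2 htr)]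
    _ = _ := by
        rw [← Finset.sum_fiberwise (Finset.univ : Finset Kˣ) (fun x => x ^ (q - 1))]
        refine Finset.sum_congr rfl fun w _ => ?_
        rw [← FiniteField.natCard_units_pow_card_sub_one_eq, Nat.card_eq_fintype_card,
          Fintype.card_subtype, ← smul_eq_mul, ← Finset.sum_const]
        refine Finset.sum_congr rfl fun x hx => ?_
        rw [(Finset.mem_filter.1 hx).2]

omit [Fintype F] in
theorem MulChar.inv_compNorm_algebraMap (χ : MulChar F ℂ) (c : F) (hc : c ≠ 0) :
    (χ.compNorm K)⁻¹ (algebraMap F K c) = (χ⁻¹ ^ Module.finrank F K) c := by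
  lift c to Fˣ using IsUnit.mk0 c hc
  rw [MulChar.inv_apply', ← map_inv₀, compNorm_apply, Algebra.norm_algebraMap, map_pow,
    ← MulChar.inv_apply', MulChar.pow_apply_coe]

theorem sum_gaussSum_mulShift (χ : MulChar F ℂ) (ψ : AddChar F ℂ) (α : K) (hα : α ≠ 0) (t : F) :
    ∑ c : F, ψ (-(c * t)) *
        gaussSum (χ.compNorm K) ((ψ.compTrace K).mulShift (algebraMap F K c * α)) =
      gaussSum (χ.compNorm K) 1 + (χ.compNorm K)⁻¹ α * gaussSum (χ.compNorm K) (ψ.compTrace K) *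
        gaussSum (χ⁻¹ ^ Module.finrank F K) (ψ.mulShift (-t)) := by
  classical
  rw [gaussSum.eq_def (χ⁻¹ ^ Module.finrank F K), Finset.mul_sum,
    ← Finset.add_sum_erase _ _ (Finset.mem_univ (0 : F)),
    ← Finset.add_sum_erase (Finset.univ : Finset F) (fun c => _ * (_ * _))
      (Finset.mem_univ (0 : F))]
  simp only [map_zero, zero_mul, neg_zero, AddChar.map_zero_eq_one, one_mul, MulChar.map_zero,
    mul_zero, zero_add, AddChar.mulShift_zero]
  congr 1
  refine Finset.sum_congr rfl fun c hc => ?_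
  have hc : c ≠ 0 := Finset.ne_of_mem_erase hc
  have hu : algebraMap F K c * α ≠ 0 := mul_ne_zero (by simpa using hc) hα
  rw [← Units.val_mk0 hu, gaussSum_mulShift_eq, Units.val_mk0, map_mul,
    MulChar.inv_compNorm_algebraMap χ c hc, AddChar.mulShift_apply]
  ring_nf

theorem natCard_artinSchreier_eq_sum_gaussSum [Fintype (MulChar F ℂ)] {ψ : AddChar F ℂ}
    (hψ : ψ.IsPrimitive) (α β : K) (hα : α ≠ 0) (htr : Algebra.trace F K β ≠ 0) :
    (Nat.card {p : K × K //
        p.2 ^ Fintype.card F - p.2 = α * p.1 ^ (Fintype.card F - 1) - β} : ℂ) =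
      ∑ χ : MulChar F ℂ, (gaussSum (χ.compNorm K) 1 +
        (χ.compNorm K)⁻¹ α * gaussSum (χ.compNorm K) (ψ.compTrace K) *
        gaussSum (χ⁻¹ ^ Module.finrank F K) (ψ.mulShift (-Algebra.trace F K β))) := by
  classical
  simp_rw [← sum_gaussSum_mulShift _ _ _ hα]
  rw [natCard_artinSchreier_eq_sum α β htr]
  have h (w : K) : ((if Algebra.norm F w = 1 then Fintype.card F - 1 else 0 : ℕ) : ℂ) *
        (if Algebra.trace F K (α * w - β) = 0 then Fintype.card F else 0 : ℕ) =
      ∑ χ : MulChar F ℂ, ∑ c : F, ψ (-(c * Algebra.trace F K β)) *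
        (χ.compNorm K w * (ψ.compTrace K).mulShift (algebraMap F K c * α) w) := by
    rw [← AddChar.sum_mulShift _ hψ, Nat.cast_ite, Nat.cast_sub Fintype.card_pos, Nat.cast_one,
      Nat.cast_zero, ← MulChar.sum_apply_eq_ite, Finset.sum_mul_sum]
    refine Finset.sum_congr rfl fun χ _ => Finset.sum_congr rfl fun c _ => ?_
    rw [AddChar.mulShift_apply, AddChar.compTrace_apply, mul_assoc, ← Algebra.smul_def, map_smul,
      MulChar.compNorm_apply, map_sub, smul_eq_mul, mul_sub, sub_eq_neg_add,
      AddChar.map_add_eq_mul]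
    ring
  push_cast
  simp_rw [gaussSum, Finset.mul_sum]
  calc _ = ∑ w : Kˣ, ∑ χ : MulChar F ℂ, ∑ c : F, ψ (-(c * Algebra.trace F K β)) *
        (χ.compNorm K w * (ψ.compTrace K).mulShift (algebraMap F K c * α) w) := by
        refine Finset.sum_congr rfl fun w _ => ?_
        rw [← h]
        push_cast
        rfl
    _ = ∑ w : K, ∑ χ : MulChar F ℂ, ∑ c : F, ψ (-(c * Algebra.trace F K β)) *
        (χ.compNorm K w * (ψ.compTrace K).mulShift (algebraMap F K c * α) w) := by
        refine sum_units_eq_sum (fun w : K => ∑ χ : MulChar F ℂ, ∑ c : F,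
          ψ (-(c * Algebra.trace F K β)) *
            (χ.compNorm K w * (ψ.compTrace K).mulShift (algebraMap F K c * α) w)) ?_
        refine Finset.sum_eq_zero fun χ _ => Finset.sum_eq_zero fun c _ => ?_
        rw [MulChar.map_zero, zero_mul, mul_zero]
    _ = _ := by
        rw [Finset.sum_comm]
        refine Finset.sum_congr rfl fun χ _ => Finset.sum_comm

end FiniteFields

/-- improved Hasse–Weil bound for the Artin–Schreier curve
`y^q - y = α x^(q-1) - β` over `F_{q^n}` when `Tr(β) ≠ 0`. -/
theorem stmt2 (q n : ℕ) (hq : IsPrimePow q) (hn : 2 ≤ n)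
    (Fq Fqn : Type) [Field Fq] [Field Fqn] [Fintype Fq] [Fintype Fqn]
    [Algebra Fq Fqn]
    (hcard : Fintype.card Fq = q) (hcardn : Fintype.card Fqn = q ^ n)
    (α β : Fqn) (hα : α ≠ 0) (hβ : β ≠ 0)
    (htr : Algebra.trace Fq Fqn β ≠ 0)
    (d : ℕ) (hd : d = Nat.gcd (q - 1) n)
    (A : ℕ)
    (hA : A = Nat.card {p : Fqn × Fqn // p.2 ^ q - p.2 = α * p.1 ^ (q - 1) - β}) :
    |(A : ℝ) - (q : ℝ) ^ n|
      ≤ (q : ℝ) ^ ((n : ℝ) / 2) * ((d : ℝ) - 1)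
        + (q : ℝ) ^ (((n : ℝ) + 1) / 2) * ((q : ℝ) - 1 - (d : ℝ)) := by
  classical
  have : Fintype (MulChar Fq ℂ) := Fintype.ofFinite _
  have hq1 : 1 < q := hcard ▸ Fintype.one_lt_card
  have hqpos : (0 : ℝ) < q := by exact_mod_cast zero_lt_one.trans hq1
  have hfin : Module.finrank Fq Fqn = n := by
    have h := Module.card_eq_pow_finrank (K := Fq) (V := Fqn)
    rw [hcard, hcardn] at h
    exact (Nat.pow_right_injective hq1 h).symm
  obtain ⟨ψ, hψa⟩ := AddChar.exists_apply_ne_zero.2 (one_ne_zero (α := Fq))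
  have hψ1 : ψ ≠ 1 := AddChar.ne_one_iff.2 ⟨1, hψa⟩
  have hψ : ψ.IsPrimitive := AddChar.IsPrimitive.of_ne_one hψ1
  set t := Algebra.trace Fq Fqn β
  have hψt : (ψ.mulShift (-t)) ≠ 1 := hψ (neg_ne_zero.2 htr)
  have hψK : ψ.compTrace Fqn ≠ 1 := AddChar.compTrace_ne_one hψ1
  let S : MulChar Fq ℂ → ℂ := fun χ => gaussSum (χ.compNorm Fqn) 1 +
        (χ.compNorm Fqn)⁻¹ α * gaussSum (χ.compNorm Fqn) (ψ.compTrace Fqn) *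
        gaussSum (χ⁻¹ ^ n) (ψ.mulShift (-t))
  have hsum : (A : ℂ) = ∑ χ, S χ := by
    subst hcard
    rw [hA, natCard_artinSchreier_eq_sum_gaussSum hψ α β hα htr, hfin]
  have hS1 : S 1 = (q : ℂ) ^ n := by
    simp only [S, MulChar.compNorm_one, inv_one, one_pow]
    rw [gaussSum_one_left hψK, gaussSum_one_left hψt, gaussSum_one_one, Nat.card_units,
      Nat.card_eq_fintype_card, hcardn, MulChar.one_apply (IsUnit.mk0 α hα),
      Nat.cast_sub (Nat.one_le_pow _ _ (zero_lt_one.trans hq1))]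
    push_cast
    ring
  have hnormK : √((q ^ n : ℕ) : ℝ) = (q : ℝ) ^ ((n : ℝ) / 2) := by
    rw [Real.sqrt_eq_rpow, Nat.cast_pow, ← Real.rpow_natCast_mul hqpos.le]
    ring_nf
  have hnormF : (q : ℝ) ^ ((n : ℝ) / 2) * √(q : ℝ) = (q : ℝ) ^ (((n : ℝ) + 1) / 2) := by
    rw [Real.sqrt_eq_rpow, ← Real.rpow_add hqpos]
    ring_nf
  have hS (χ : MulChar Fq ℂ) (hχ : χ ≠ 1) :
      ‖S χ‖ = if χ ^ n = 1 then (q : ℝ) ^ ((n : ℝ) / 2) else (q : ℝ) ^ (((n : ℝ) + 1) / 2) := by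
    have hχK := MulChar.compNorm_ne_one (K := Fqn) hχ
    have hα1 : ‖(χ.compNorm Fqn)⁻¹ α‖ = 1 :=
      MulChar.norm_apply_eq_one _ hα
    simp only [S]
    rw [gaussSum_one_right hχK, zero_add, norm_mul, norm_mul, hα1, one_mul,
      norm_gaussSum_eq_sqrt_card hχK (AddChar.IsPrimitive.of_ne_one hψK), hcardn, hnormK]
    split_ifs with h
    · rw [inv_pow, h, inv_one, gaussSum_one_left hψt, norm_neg, norm_one, mul_one]
    · rw [norm_gaussSum_eq_sqrt_card (by simpa using h) (AddChar.IsPrimitive.of_ne_one hψt),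
        hcard, hnormF]
  have hcardchar : Fintype.card (MulChar Fq ℂ) = q - 1 := by
    rw [← Nat.card_eq_fintype_card, MulChar.card_eq_card_units_of_hasEnoughRootsOfUnity,
      Nat.card_units, Nat.card_eq_fintype_card, hcard]
  have hd' := MulChar.card_pow_eq_one (F := Fq) n
  rw [hcard, ← hd] at hd'
  have hcompl : (Finset.card {χ : MulChar Fq ℂ | ¬ χ ^ n = 1} : ℝ) = (q : ℝ) - 1 - d := by
    have h := Finset.card_filter_add_card_filter_not (s := (Finset.univ : Finset (MulChar Fq ℂ)))
      (fun χ => χ ^ n = 1)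
    rw [Finset.card_univ, hcardchar, hd'] at h
    have h2 : d + Finset.card {χ : MulChar Fq ℂ | ¬ χ ^ n = 1} + 1 = q := by omega
    rw [← h2]
    push_cast
    ring
  have key : (A : ℂ) - (q : ℂ) ^ n = ∑ χ ∈ Finset.univ.erase 1, S χ := by
    rw [hsum, ← Finset.add_sum_erase _ _ (Finset.mem_univ 1), hS1, add_sub_cancel_left]
  have hnorm : |(A : ℝ) - (q : ℝ) ^ n| = ‖(A : ℂ) - (q : ℂ) ^ n‖ := by
    rw [← Real.norm_eq_abs, ← Complex.norm_real]
    push_cast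
    rfl
  rw [hnorm, key]
  refine (norm_sum_le _ _).trans (le_of_eq ?_)
  rw [Finset.sum_congr rfl fun χ hχ => hS χ (Finset.ne_of_mem_erase hχ),
    Finset.sum_erase_eq_sub (Finset.mem_univ _), Finset.sum_ite, Finset.sum_const,
    Finset.sum_const, if_pos (one_pow n), hd', nsmul_eq_mul, nsmul_eq_mul, hcompl]
  ring
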